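/- The quotient of ℤ⁷ by the subgroup generated by the vectors (2,−1,−1,−1,−1,−1,−1), (0,0,0,0,0,1,−1), (0,0,0,1,−1,0,0) and (0,0,1,−1,0,0,0) is torsion-free. (This is the singularity type A₂ + 2A₁.) -/

import Mathlib

theorem mem_span_iff_aux (x : Fin 7 → ℤ) :
    x ∈ Submodule.span ℤ ({![2,-1,-1,-1,-1,-1,-1], ![0,0,0,0,0,1,-1], ![0,0,0,1,-1,0,0], ![0,0,1,-1,0,0,0]} : Set (Fin 7 → ℤ)) ↔
      x 0 = -2 * x 1 ∧ x 2 + x 3 + x 4 = 3 * x 1 ∧ x 5 + x 6 = 2 * x 1 := by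
  simp only [Submodule.mem_span_insert, Submodule.mem_span_singleton]
  constructor
  · rintro ⟨a, _, ⟨b, _, ⟨c, _, ⟨d, rfl⟩, rfl⟩, rfl⟩, rfl⟩
    simp
    refine ⟨?_, ?_, ?_⟩ <;> ring
  · rintro ⟨h1, h2, h3⟩
    refine ⟨-x 1, _, ⟨x 5 - x 1, _, ⟨x 1 - x 4, _, ⟨x 2 - x 1, rfl⟩, rfl⟩, rfl⟩, ?_⟩
    ext i
    fin_cases i <;> simp <;> linarith

theorem quotient_torsionFree :
    IsAddTorsionFree
      ((Fin 7 → ℤ) ⧸ Submodule.span ℤ ({![2,-1,-1,-1,-1,-1,-1], ![0,0,0,0,0,1,-1], ![0,0,0,1,-1,0,0], ![0,0,1,-1,0,0,0]} : Set (Fin 7 → ℤ))) := by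
  constructor
  intro n hn p q h
  obtain ⟨x, rfl⟩ := Submodule.Quotient.mk_surjective _ p
  obtain ⟨y, rfl⟩ := Submodule.Quotient.mk_surjective _ q
  have hn' : (n : ℤ) ≠ 0 := by exact_mod_cast hn
  simp only [← Submodule.Quotient.mk_smul] at h
  rw [Submodule.Quotient.eq, mem_span_iff_aux] at h ⊢
  simp only [Pi.sub_apply, nsmul_eq_mul, Pi.mul_apply, Pi.natCast_apply] at h ⊢
  obtain ⟨h1, h2, h3⟩ := h
  refine ⟨mul_left_cancel₀ hn' ?_, mul_left_cancel₀ hn' ?_, mul_left_cancel₀ hn' ?_⟩ <;> linarith
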